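/- arXiv:1603.08450 — 3 statements merged into one kernel-verified Lean document; each statement's English description precedes it below -/
import Mathlib

section
/- Let n ≥ 2 be even, n = 2k, and let P₀, …, Pₙ ∈ ℝ³. Let B be the Bézier curve of degree n with control points P and let 𝒫 : [0,1] → ℝ³ be the uniform piecewise-linear parametrization of P₀, …, Pₙ. Then for every t ∈ [0,1] and every coordinate w ∈ {x,y,z}, |B(t)ʷ − 𝒫(t)ʷ| ≤ N₁(n)·‖Δ₂P‖_{1,M}, where N₁(2k) = C(2k,k)·(2k)/2^{2k+2}. -/
/-- The Bézier curve of degree `m` with control points `R 0, …, R m` in `ℝ³`. -/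
noncomputable def bezier (m : ℕ) (R : ℕ → EuclideanSpace ℝ (Fin 3)) (t : ℝ) :
    EuclideanSpace ℝ (Fin 3) :=
  ∑ i ∈ Finset.range (m + 1), ((m.choose i : ℝ) * t ^ i * (1 - t) ^ (m - i)) • R i

/-- The uniform piecewise-linear parametrization of points `R 0, …, R m`:
`𝒫 (k/m) = R k` and `𝒫` is affine on each interval `[k/m, (k+1)/m]`. -/
noncomputable def plParam (m : ℕ) (R : ℕ → EuclideanSpace ℝ (Fin 3)) (t : ℝ) :
    EuclideanSpace ℝ (Fin 3) :=
  R ⌊(m : ℝ) * t⌋₊ +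
    ((m : ℝ) * t - ⌊(m : ℝ) * t⌋₊) • (R (⌊(m : ℝ) * t⌋₊ + 1) - R ⌊(m : ℝ) * t⌋₊)

/-- Second forward difference `Δ₂Rᵢ = R (i+2) - 2 R (i+1) + R i`. -/
noncomputable def delta2 (R : ℕ → EuclideanSpace ℝ (Fin 3)) (i : ℕ) :
    EuclideanSpace ℝ (Fin 3) :=
  R (i + 2) - (2 : ℝ) • R (i + 1) + R i

/-- `‖Δ₂R‖_{1,M}` for points `R 0, …, R m`: the maximum over coordinates `w` of the
1-norm `Σ_{i=0}^{m-2} |Δ₂Rᵢʷ|`. -/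
noncomputable def norm1M (m : ℕ) (R : ℕ → EuclideanSpace ℝ (Fin 3)) : ℝ :=
  ⨆ w : Fin 3, ∑ i ∈ Finset.range (m - 1), |delta2 R i w|

/-- The expectation of `f` under the binomial distribution with parameters `n` and `p`. -/
noncomputable def binomialMean (n : ℕ) (p : ℝ) (f : ℕ → ℝ) : ℝ :=
  ∑ i ∈ Finset.range (n + 1), (n.choose i : ℝ) * p ^ i * (1 - p) ^ (n - i) * f i

/-- The piecewise-linear interpolation at `x` of the values of `f` at the natural numbers. -/
noncomputable def linearInterp (x : ℝ) (f : ℕ → ℝ) : ℝ :=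
  f ⌊x⌋₊ + (x - ⌊x⌋₊) * (f (⌊x⌋₊ + 1) - f ⌊x⌋₊)

namespace binomialMean

theorem zero_left (p : ℝ) (f : ℕ → ℝ) : binomialMean 0 p f = f 0 := by
  simp [binomialMean]

theorem succ_left (n : ℕ) (p : ℝ) (f : ℕ → ℝ) :
    binomialMean (n + 1) p f =
      (1 - p) * binomialMean n p f + p * binomialMean n p (fun i => f (i + 1)) := by
  have key (m : ℕ) (g : ℕ → ℝ) : binomialMean m p g =
      ∑ ij ∈ Finset.HasAntidiagonal.antidiagonal m,
        (m.choose ij.1 : ℝ) * (p ^ ij.1 * (1 - p) ^ ij.2 * g ij.1) := by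
    rw [Finset.Nat.sum_antidiagonal_eq_sum_range_succ_mk, binomialMean]
    exact Finset.sum_congr rfl fun i _ => by ring
  rw [key, key, key,
    Finset.sum_antidiagonal_choose_succ_mul (fun i j => p ^ i * (1 - p) ^ j * f i) n,
    Finset.mul_sum, Finset.mul_sum]
  congr 1
  · exact Finset.sum_congr rfl fun ij _ => by ring
  · refine Finset.sum_congr rfl fun ij hij => ?_
    rw [← Nat.choose_symm_of_eq_add (Finset.HasAntidiagonal.mem_antidiagonal.mp hij).symm]
    ring

theorem mono {p : ℝ} (hp : 0 ≤ p) (hp' : p ≤ 1) (n : ℕ) {f g : ℕ → ℝ} (h : ∀ i, f i ≤ g i) :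
    binomialMean n p f ≤ binomialMean n p g := by
  have := sub_nonneg.mpr hp'
  refine Finset.sum_le_sum fun i _ => mul_le_mul_of_nonneg_left (h i) (by positivity)

theorem affine (n : ℕ) (p a b : ℝ) :
    binomialMean n p (fun i => a + b * i) = a + b * (n * p) := by
  induction n generalizing a with
  | zero => simp [zero_left]
  | succ n ih =>
    have h : (fun i : ℕ => a + b * ((i + 1 : ℕ) : ℝ)) = fun i : ℕ => (a + b) + b * (i : ℝ) := by
      funext i; push_cast; ring
    rw [succ_left, h, ih, ih]
    push_cast
    ring

theorem add (n : ℕ) (p : ℝ) (f g : ℕ → ℝ) :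
    binomialMean n p (fun i => f i + g i) = binomialMean n p f + binomialMean n p g := by
  simp only [binomialMean, mul_add, Finset.sum_add_distrib]

theorem sub (n : ℕ) (p : ℝ) (f g : ℕ → ℝ) :
    binomialMean n p (fun i => f i - g i) = binomialMean n p f - binomialMean n p g := by
  simp only [binomialMean, mul_sub, Finset.sum_sub_distrib]

theorem sum_mul (n : ℕ) (p : ℝ) (s : Finset ℕ) (c : ℕ → ℝ) (f : ℕ → ℕ → ℝ) :
    binomialMean n p (fun i => ∑ j ∈ s, c j * f j i) = ∑ j ∈ s, c j * binomialMean n p (f j) := by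
  simp only [binomialMean, Finset.mul_sum]
  rw [Finset.sum_comm]
  exact Finset.sum_congr rfl fun j _ => Finset.sum_congr rfl fun i _ => by ring

theorem congr {n : ℕ} (p : ℝ) {f g : ℕ → ℝ} (h : ∀ i ≤ n, f i = g i) :
    binomialMean n p f = binomialMean n p g :=
  Finset.sum_congr rfl fun i hi => by rw [h i (by simpa [Nat.lt_succ_iff] using hi)]

/-- The binomial distributions are stochastically increasing in the success probability. -/
theorem le_of_monotone {f : ℕ → ℝ} (hf : Monotone f) (n : ℕ) {p q : ℝ} (hp : 0 ≤ p)
    (hpq : p ≤ q) (hq : q ≤ 1) : binomialMean n p f ≤ binomialMean n q f := by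
  induction n generalizing f with
  | zero => simp [zero_left]
  | succ n ih =>
    have h₁ := ih hf
    have h₂ := ih (f := fun i => f (i + 1)) fun i j hij => hf (Nat.succ_le_succ hij)
    have h₃ := mono (hp.trans hpq) hq n fun i => hf (Nat.le_succ i)
    rw [succ_left, succ_left]
    simp only [Nat.succ_eq_add_one] at h₃
    nlinarith [mul_le_mul_of_nonneg_left h₁ (sub_nonneg.mpr (hpq.trans hq)),
      mul_le_mul_of_nonneg_left h₂ hp, mul_nonneg (sub_nonneg.mpr hpq) (sub_nonneg.mpr h₃)]

/-- De Moivre's formula for the positive part of the deviation of a binomial variable from an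
integral mean. -/
theorem hinge_of_mul_eq {n m : ℕ} {p : ℝ} (hm : m ≤ n) (hp : n * p = m) :
    binomialMean n p (fun i => max ((i : ℝ) - m) 0) =
      m * n.choose m * p ^ m * (1 - p) ^ (n - m + 1) := by
  set T : ℕ → ℝ := fun i => i * n.choose i * p ^ i * (1 - p) ^ (n - i + 1) with hT
  have hstep : ∀ i ∈ Finset.Ico m (n + 1),
      (n.choose i : ℝ) * p ^ i * (1 - p) ^ (n - i) * max ((i : ℝ) - m) 0 =
        -(T (i + 1) - T i) := by
    intro i hi
    obtain ⟨hmi, hin⟩ := Finset.mem_Ico.mp hi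
    have hmi' : (m : ℝ) ≤ i := by exact_mod_cast hmi
    rw [max_eq_left (sub_nonneg.mpr hmi'), ← hp]
    rcases (Nat.lt_succ_iff.mp hin).lt_or_eq with h | rfl
    · obtain ⟨d, rfl⟩ := Nat.exists_eq_add_of_lt h
      have hc := Nat.choose_succ_right_eq (i + d + 1) i
      rw [show i + d + 1 - i = d + 1 by omega] at hc
      have hc' : (((i + d + 1).choose (i + 1) : ℕ) : ℝ) * (i + 1) =
          ((i + d + 1).choose i : ℕ) * (d + 1) := by exact_mod_cast hc
      simp only [hT, show i + d + 1 - i = d + 1 by omega, show i + d + 1 - (i + 1) = d by omega]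
      push_cast
      linear_combination (p ^ (i + 1) * (1 - p) ^ (d + 1)) * hc'
    · simp [hT]
      ring
  have hsub : Finset.Ico m (n + 1) ⊆ Finset.range (n + 1) := fun i hi =>
    Finset.mem_range.mpr (Finset.mem_Ico.mp hi).2
  rw [binomialMean, ← Finset.sum_subset hsub, Finset.sum_congr rfl hstep,
    Finset.sum_neg_distrib, Finset.sum_Ico_sub T (by omega)]
  · simp [hT]
  · intro i hi hi'
    have him : (i : ℝ) ≤ m := by
      have : i ≤ m := by
        simp only [Finset.mem_range, Finset.mem_Ico] at hi hi'
        omega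
      exact_mod_cast this
    rw [max_eq_right (sub_nonpos.mpr him), mul_zero]

theorem hinge_ge {p : ℝ} (hp : 0 ≤ p) (hp' : p ≤ 1) (n m : ℕ) :
    max (n * p - m) 0 ≤ binomialMean n p (fun i => max ((i : ℝ) - m) 0) := by
  refine max_le ?_ ?_
  · have h := affine n p (-m) 1
    have h' := mono hp hp' n (f := fun i => -(m : ℝ) + 1 * i)
      (g := fun i => max ((i : ℝ) - m) 0) fun i => le_max_of_le_left (by linarith)
    linarith
  · have h := affine n p 0 0
    have h' := mono hp hp' n (f := fun i => (0 : ℝ) + 0 * i)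
      (g := fun i => max ((i : ℝ) - m) 0) fun i => le_max_of_le_right (by simp)
    linarith

/-- The gap in Jensen's inequality for a hinge function is largest when the mean is at the hinge. -/
theorem hinge_sub_le {n m : ℕ} {p q : ℝ} (hp : 0 ≤ p) (hp' : p ≤ 1) (hq : 0 ≤ q) (hq' : q ≤ 1)
    (hn : 0 < n) (hqm : n * q = m) :
    binomialMean n p (fun i => max ((i : ℝ) - m) 0) - max (n * p - m) 0 ≤
      binomialMean n q (fun i => max ((i : ℝ) - m) 0) := by
  have hn' : (0 : ℝ) < n := by exact_mod_cast hn
  rcases le_total p q with h | h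
  · have hmono : Monotone fun i : ℕ => max ((i : ℝ) - m) 0 := fun i j hij => by
      have : (i : ℝ) ≤ j := by exact_mod_cast hij
      exact max_le_max_right _ (by linarith)
    linarith [le_of_monotone hmono n hp h hq', le_max_right (n * p - m) 0]
  · have hmono : Monotone fun i : ℕ => (0 + 1 * (i : ℝ)) - max ((i : ℝ) - m) 0 :=
      fun i j hij => by
        have hij' : (i : ℝ) ≤ j := by exact_mod_cast hij
        have : max ((j : ℝ) - m) 0 ≤ max ((i : ℝ) - m) 0 + (j - i) :=
          max_le (by linarith [le_max_left ((i : ℝ) - m) 0])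
            (by linarith [le_max_right ((i : ℝ) - m) 0])
        simp only
        linarith
    have := le_of_monotone hmono n hq h hp'
    rw [sub n q, sub n p, affine, affine] at this
    linarith [le_max_left (n * p - m) 0]

end binomialMean

namespace linearInterp

theorem affine (x a b : ℝ) : linearInterp x (fun i => a + b * i) = a + b * x := by
  simp only [linearInterp]
  push_cast
  ring

theorem add (x : ℝ) (f g : ℕ → ℝ) :
    linearInterp x (fun i => f i + g i) = linearInterp x f + linearInterp x g := by
  simp only [linearInterp]
  ring

theorem sum_mul (x : ℝ) (s : Finset ℕ) (c : ℕ → ℝ) (f : ℕ → ℕ → ℝ) :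
    linearInterp x (fun i => ∑ j ∈ s, c j * f j i) = ∑ j ∈ s, c j * linearInterp x (f j) := by
  simp only [linearInterp, ← Finset.sum_sub_distrib, Finset.mul_sum, ← Finset.sum_add_distrib]
  exact Finset.sum_congr rfl fun j _ => by ring

theorem congr {n : ℕ} {x : ℝ} (hx : 0 ≤ x) (hxn : x ≤ n) {f g : ℕ → ℝ}
    (h : ∀ i ≤ n, f i = g i) : linearInterp x f = linearInterp x g := by
  have hfl : ⌊x⌋₊ ≤ n := Nat.floor_le_of_le hxn
  rcases hfl.lt_or_eq with hlt | heq
  · rw [linearInterp, linearInterp, h _ hfl, h _ hlt]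
  · have hxeq : x - ⌊x⌋₊ = 0 := by
      have := Nat.floor_le hx
      rw [heq] at this ⊢
      linarith
    rw [linearInterp, linearInterp, h _ hfl, hxeq, zero_mul, zero_mul]

theorem hinge {x : ℝ} (hx : 0 ≤ x) (m : ℕ) :
    linearInterp x (fun i => max ((i : ℝ) - m) 0) = max (x - m) 0 := by
  have h₁ := Nat.floor_le hx
  have h₂ := Nat.lt_floor_add_one x
  simp only [linearInterp]
  push_cast
  rcases le_or_gt m ⌊x⌋₊ with h | h
  · have h' : (m : ℝ) ≤ ⌊x⌋₊ := by exact_mod_cast h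
    rw [max_eq_left (by linarith), max_eq_left (by linarith), max_eq_left (by linarith)]
    ring
  · have h' : (⌊x⌋₊ : ℝ) + 1 ≤ m := by exact_mod_cast h
    rw [max_eq_right (by linarith), max_eq_right (by linarith), max_eq_right (by linarith)]
    ring

end linearInterp

/-- Discrete Taylor expansion of order two with integral remainder. -/
theorem eq_affine_add_sum_hinge (f : ℕ → ℝ) {N i : ℕ} (hi : i ≤ N + 1) :
    f i = f 0 + (f 1 - f 0) * i + ∑ j ∈ Finset.range N,
      (f (j + 2) - 2 * f (j + 1) + f j) * max ((i : ℝ) - (j + 1 : ℕ)) 0 := by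
  induction N generalizing i with
  | zero => interval_cases i <;> simp
  | succ N ih =>
    rw [Finset.sum_range_succ]
    rcases hi.lt_or_eq with hlt | rfl
    · have : (i : ℝ) ≤ (N + 1 : ℕ) := by exact_mod_cast Nat.lt_succ_iff.mp hlt
      rw [max_eq_right (sub_nonpos.mpr this), mul_zero, add_zero]
      exact ih (Nat.lt_succ_iff.mp hlt)
    · have hsum : ∑ j ∈ Finset.range N, (f (j + 2) - 2 * f (j + 1) + f j) *
          max (((N + 1 + 1 : ℕ) : ℝ) - (j + 1 : ℕ)) 0 =
          2 * ∑ j ∈ Finset.range N, (f (j + 2) - 2 * f (j + 1) + f j) *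
            max (((N + 1 : ℕ) : ℝ) - (j + 1 : ℕ)) 0 -
          ∑ j ∈ Finset.range N, (f (j + 2) - 2 * f (j + 1) + f j) *
            max (((N : ℕ) : ℝ) - (j + 1 : ℕ)) 0 := by
        rw [Finset.mul_sum, ← Finset.sum_sub_distrib]
        refine Finset.sum_congr rfl fun j hj => ?_
        have hj' : (j : ℝ) + 1 ≤ N := by exact_mod_cast Finset.mem_range.mp hj
        push_cast
        rw [max_eq_left (by linarith), max_eq_left (by linarith), max_eq_left (by linarith)]
        ring
      have e₁ := ih (i := N + 1) le_rfl
      have e₂ := ih (i := N) (Nat.le_succ N)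
      rw [hsum, max_eq_left (by push_cast; linarith)]
      push_cast at e₁ e₂ ⊢
      linarith

theorem antitone_one_add_inv_pow :
    Antitone fun j : ℕ => (((j : ℝ) + 2) / (j + 1)) ^ (j + 2) := by
  refine antitone_nat_of_succ_le fun j => ?_
  have hu : (0 : ℝ) < (j + 2) / (j + 1) := by positivity
  have hc := one_add_mul_le_pow (a := 1 / (((j : ℝ) + 1) * (j + 3)))
    (by linarith [show (0 : ℝ) ≤ 1 / (((j : ℝ) + 1) * (j + 3)) by positivity]) (j + 3)
  have hc' : 1 + ((j + 3 : ℕ) : ℝ) * (1 / (((j : ℝ) + 1) * (j + 3))) = (j + 2) / (j + 1) := by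
    push_cast
    field_simp
    ring
  have huv : ((j : ℝ) + 2) / (j + 1) =
      ((j + 3) / (j + 2)) * (1 + 1 / (((j : ℝ) + 1) * (j + 3))) := by
    field_simp
    ring
  rw [hc'] at hc
  refine le_of_mul_le_mul_right ?_ hu
  have hv : (((j + 1 : ℕ) : ℝ) + 2) / ((j + 1 : ℕ) + 1) = (j + 3) / (j + 2) := by
    push_cast
    ring_nf
  rw [hv, ← pow_succ]
  calc (((j : ℝ) + 3) / (j + 2)) ^ (j + 1 + 2) * ((j + 2) / (j + 1))
      ≤ ((j + 3) / (j + 2)) ^ (j + 3) * (1 + 1 / (((j : ℝ) + 1) * (j + 3))) ^ (j + 3) :=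
        mul_le_mul_of_nonneg_left hc (by positivity)
    _ = ((j + 2) / (j + 1)) ^ (j + 2 + 1) := by rw [← mul_pow, ← huv]

theorem pow_succ_div_factorial_mul_le (d i : ℕ) :
    ((i : ℝ) ^ (i + 1) / i.factorial) *
        (((i + 2 * d : ℕ) : ℝ) ^ (i + 2 * d + 1) / (i + 2 * d).factorial) ≤
      (((i + d : ℕ) : ℝ) ^ (i + d + 1) / (i + d).factorial) ^ 2 := by
  set a : ℕ → ℝ := fun j => (j : ℝ) ^ (j + 1) / j.factorial with ha
  change a i * a (i + 2 * d) ≤ a (i + d) ^ 2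
  have hnonneg (j : ℕ) : 0 ≤ a j := by positivity
  have hratio (j : ℕ) : a (j + 2) = (((j : ℝ) + 2) / (j + 1)) ^ (j + 2) * a (j + 1) := by
    simp only [ha, Nat.factorial_succ (j + 1), div_pow]
    push_cast
    field_simp
    ring
  induction d generalizing i with
  | zero => simp [sq]
  | succ d ih =>
    have h := ih (i + 1)
    rw [show i + 1 + d = i + (d + 1) by ring] at h
    refine le_trans ?_ h
    rcases i with _ | i
    · have : a 0 = 0 := by simp [ha]
      rw [this, zero_mul]
      exact mul_nonneg (hnonneg _) (hnonneg _)
    · rw [show i + 1 + 2 * (d + 1) = (i + 2 * d + 1) + 2 by ring, hratio (i + 2 * d + 1),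
        show i + 1 + 1 = i + 2 by ring, hratio i,
        show i + 2 + 2 * d = i + 2 * d + 1 + 1 by ring]
      have hr := antitone_one_add_inv_pow (show i ≤ i + 2 * d + 1 by omega)
      simp only at hr
      nlinarith [mul_le_mul_of_nonneg_right hr
        (mul_nonneg (hnonneg (i + 1)) (hnonneg (i + 2 * d + 1 + 1)))]

theorem pow_succ_div_factorial_mul_le_of_add_eq {i j k : ℕ} (h : i + j = 2 * k) :
    ((i : ℝ) ^ (i + 1) / i.factorial) * ((j : ℝ) ^ (j + 1) / j.factorial) ≤
      ((k : ℝ) ^ (k + 1) / k.factorial) ^ 2 := by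
  wlog hij : i ≤ j generalizing i j
  · rw [mul_comm]
    exact this (by omega) (by omega)
  obtain ⟨d, rfl⟩ : ∃ d, k = i + d := ⟨k - i, by omega⟩
  obtain rfl : j = i + 2 * d := by omega
  exact pow_succ_div_factorial_mul_le d i

theorem mul_choose_mul_pow_le {k m : ℕ} (hk : 1 ≤ k) (hm : m ≤ 2 * k) :
    (m : ℝ) * (2 * k).choose m * ((m : ℝ) / (2 * k)) ^ m *
        (1 - (m : ℝ) / (2 * k)) ^ (2 * k - m + 1) ≤
      ((2 * k).choose k : ℝ) * (2 * k) / 2 ^ (2 * k + 2) := by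
  obtain ⟨l, hl⟩ := Nat.exists_eq_add_of_le hm
  have hk' : (0 : ℝ) < k := by exact_mod_cast hk
  have hlr : (2 * k : ℝ) = m + l := by exact_mod_cast hl
  have hq : 1 - (m : ℝ) / (2 * k) = l / (2 * k) := by
    field_simp
    linarith
  have h := pow_succ_div_factorial_mul_le_of_add_eq hl.symm
  have hc : ((2 * k).choose m : ℝ) = (2 * k).factorial / (m.factorial * l.factorial) := by
    rw [Nat.cast_choose ℝ hm, show 2 * k - m = l by omega]
  have hc' : ((2 * k).choose k : ℝ) = (2 * k).factorial / (k.factorial * k.factorial) := by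
    rw [Nat.cast_choose ℝ (by omega), show 2 * k - k = k by omega]
  have hpow : (2 * k : ℝ) ^ m * (2 * k) ^ (l + 1) = (2 * k) ^ (2 * k + 1) := by
    rw [← pow_add, hl, add_assoc]
  rw [hq, show 2 * k - m + 1 = l + 1 by omega, hc, hc']
  calc (m : ℝ) * ((2 * k).factorial / (m.factorial * l.factorial)) * ((m : ℝ) / (2 * k)) ^ m *
        ((l : ℝ) / (2 * k)) ^ (l + 1)
      = ((2 * k).factorial / (2 * k : ℝ) ^ (2 * k + 1)) *
          (((m : ℝ) ^ (m + 1) / m.factorial) * ((l : ℝ) ^ (l + 1) / l.factorial)) := by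
        rw [← hpow, div_pow, div_pow]
        field_simp
        ring
    _ ≤ ((2 * k).factorial / (2 * k : ℝ) ^ (2 * k + 1)) *
          ((k : ℝ) ^ (k + 1) / k.factorial) ^ 2 :=
        mul_le_mul_of_nonneg_left h (by positivity)
    _ = _ := by
        rw [mul_pow]
        field_simp
        ring

/-- A function on `0, …, n` with `n = 2 * k`: its Bernstein approximation differs from its
piecewise-linear interpolation by at most a multiple of the `1`-norm of its second differences. -/
theorem abs_binomialMean_sub_linearInterp_le {k : ℕ} (hk : 1 ≤ k) (f : ℕ → ℝ) {t : ℝ}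
    (ht : 0 ≤ t) (ht' : t ≤ 1) :
    |binomialMean (2 * k) t f - linearInterp ((2 * k : ℕ) * t) f| ≤
      (((2 * k).choose k : ℝ) * (2 * k) / 2 ^ (2 * k + 2)) *
        ∑ j ∈ Finset.range (2 * k - 1), |f (j + 2) - 2 * f (j + 1) + f j| := by
  have hx : (0 : ℝ) ≤ (2 * k : ℕ) * t := by positivity
  have hxn : ((2 * k : ℕ) : ℝ) * t ≤ (2 * k : ℕ) := mul_le_of_le_one_right (by positivity) ht'
  have hf : ∀ i ≤ 2 * k, f i = _ := fun i hi =>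
    eq_affine_add_sum_hinge f (N := 2 * k - 1) (i := i) (by omega)
  rw [binomialMean.congr t hf, linearInterp.congr hx hxn hf, binomialMean.add, linearInterp.add,
    binomialMean.affine, linearInterp.affine, add_sub_add_left_eq_sub,
    binomialMean.sum_mul (2 * k) t _ (fun j => f (j + 2) - 2 * f (j + 1) + f j)
      (fun j i => max ((i : ℝ) - (j + 1 : ℕ)) 0),
    linearInterp.sum_mul _ _ (fun j => f (j + 2) - 2 * f (j + 1) + f j)
      (fun j i => max ((i : ℝ) - (j + 1 : ℕ)) 0), ← Finset.sum_sub_distrib, Finset.mul_sum]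
  refine (Finset.abs_sum_le_sum_abs _ _).trans (Finset.sum_le_sum fun j hj => ?_)
  have hj' : j + 1 ≤ 2 * k := by
    have := Finset.mem_range.mp hj
    omega
  have hk' : (0 : ℝ) < 2 * k := by positivity
  have hjr : ((j + 1 : ℕ) : ℝ) ≤ 2 * k := by exact_mod_cast hj'
  rw [linearInterp.hinge hx, ← mul_sub, abs_mul, mul_comm,
    abs_of_nonneg (sub_nonneg.mpr (binomialMean.hinge_ge ht ht' _ _))]
  have hq : ((2 * k : ℕ) : ℝ) * (((j + 1 : ℕ) : ℝ) / (2 * k)) = (j + 1 : ℕ) := by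
    push_cast
    field_simp
  refine mul_le_mul_of_nonneg_right ?_ (abs_nonneg _)
  refine (binomialMean.hinge_sub_le ht ht' (by positivity) ((div_le_one hk').mpr hjr)
    (by omega) hq).trans ?_
  rw [binomialMean.hinge_of_mul_eq hj' hq]
  exact mul_choose_mul_pow_le hk hj'

/-- For even degree `n = 2k ≥ 2`, the coordinatewise distance between the Bézier curve
and its uniformly parametrized control polygon is at most `N₁(n)·‖Δ₂P‖_{1,M}`, where
`N₁(2k) = C(2k,k)·(2k)/2^{2k+2}`. -/
theorem bezier_polygon_dist (n k : ℕ) (hk : 1 ≤ k) (hnk : n = 2 * k)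
    (P : ℕ → EuclideanSpace ℝ (Fin 3)) (t : ℝ) (ht : t ∈ Set.Icc (0 : ℝ) 1)
    (w : Fin 3) :
    |bezier n P t w - plParam n P t w| ≤
      (((2 * k).choose k : ℝ) * (2 * k) / 2 ^ (2 * k + 2)) * norm1M n P := by
  subst hnk
  have hb : bezier (2 * k) P t w = binomialMean (2 * k) t (fun i => P i w) := by
    simp [bezier, binomialMean]
  have hp : plParam (2 * k) P t w = linearInterp ((2 * k : ℕ) * t) (fun i => P i w) := by
    simp [plParam, linearInterp]
  rw [hb, hp]
  refine (abs_binomialMean_sub_linearInterp_le hk _ ht.1 ht.2).trans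
    (mul_le_mul_of_nonneg_left ?_ (by positivity))
  have h := le_ciSup (Set.finite_range fun v : Fin 3 =>
    ∑ i ∈ Finset.range (2 * k - 1), |delta2 P i v|).bddAbove w
  simpa [norm1M, delta2] using h
end

section
/- Let n ≥ 2 be even and let P₀, …, Pₙ ∈ ℝ³. For j ≥ 0 let P^{(j)} be the j-fold midpoint insertion of P, let B^{(j)} be the Bézier curve of degree 2^j·n with control points P^{(j)}, and let 𝒫^{(j)} be the uniform piecewise-linear parametrization of P^{(j)}. Then for every j ≥ 0, every t ∈ [0,1], and every coordinate w ∈ {x,y,z}, |B^{(j)}(t)ʷ − 𝒫^{(j)}(t)ʷ| ≤ (n / (4·√(n·2^j + 1)))·‖Δ₂P‖_{1,M}. -/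
/-- Midpoint insertion: from points `R 0, …, R m` produce `S 0, …, S (2m)` with
`S (2i) = R i` and `S (2i+1) = (R i + R (i+1)) / 2`. -/
noncomputable def minsert (R : ℕ → EuclideanSpace ℝ (Fin 3)) (i : ℕ) :
    EuclideanSpace ℝ (Fin 3) :=
  if i % 2 = 0 then R (i / 2) else (2⁻¹ : ℝ) • (R (i / 2) + R (i / 2 + 1))

/-- The Bernstein weight `C(m,i) tⁱ (1-t)^(m-i)`. -/
noncomputable def bernsteinWeight (m : ℕ) (t : ℝ) (i : ℕ) : ℝ :=
  (m.choose i : ℝ) * t ^ i * (1 - t) ^ (m - i)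

theorem bernsteinWeight_nonneg (m : ℕ) {t : ℝ} (ht : t ∈ Set.Icc (0 : ℝ) 1) (i : ℕ) :
    0 ≤ bernsteinWeight m t i := by
  have h0 := ht.1
  have h1 : 0 ≤ 1 - t := sub_nonneg.2 ht.2
  unfold bernsteinWeight
  positivity

theorem sum_bernsteinWeight (m : ℕ) (t : ℝ) :
    ∑ i ∈ Finset.range (m + 1), bernsteinWeight m t i = 1 := by
  have h := congrArg (Polynomial.eval t) (bernsteinPolynomial.sum ℝ m)
  simpa [Polynomial.eval_finsetSum, bernsteinPolynomial, bernsteinWeight] using h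

theorem sum_sq_mul_bernsteinWeight (m : ℕ) (t : ℝ) :
    ∑ i ∈ Finset.range (m + 1), ((i : ℝ) - m * t) ^ 2 * bernsteinWeight m t i
      = m * t * (1 - t) := by
  have h := congrArg (Polynomial.eval t) (bernsteinPolynomial.variance ℝ m)
  simp only [Polynomial.eval_finsetSum, bernsteinPolynomial, nsmul_eq_mul,
    Polynomial.eval_mul, Polynomial.eval_pow, Polynomial.eval_sub, Polynomial.eval_natCast,
    Polynomial.eval_X, Polynomial.eval_one] at h
  rw [← h]
  refine Finset.sum_congr rfl fun i _ => ?_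
  unfold bernsteinWeight
  ring

theorem succ_mul_bernsteinWeight_succ (m : ℕ) (t : ℝ) {i : ℕ} (hi : i ≤ m) :
    ((i : ℝ) + 1) * (1 - t) * bernsteinWeight m t (i + 1)
      = ((m : ℝ) - i) * t * bernsteinWeight m t i := by
  rcases hi.eq_or_lt with rfl | hlt
  · simp [bernsteinWeight]
  have hc : (m.choose (i + 1) : ℝ) * (i + 1) = m.choose i * ((m : ℝ) - i) := by
    have h := Nat.choose_succ_right_eq m i
    rw [← Nat.cast_sub hi]
    exact_mod_cast h
  have hp : (1 - t) ^ (m - i) = (1 - t) ^ (m - (i + 1)) * (1 - t) := by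
    rw [← pow_succ]
    congr 1
    omega
  unfold bernsteinWeight
  rw [hp, pow_succ]
  linear_combination t ^ i * t * (1 - t) ^ (m - (i + 1)) * (1 - t) * hc

/-- De Moivre's formula for the partial first central moments of a binomial law. -/
theorem sum_range_sub_mul_bernsteinWeight (m : ℕ) (t : ℝ) {k : ℕ} (hk : k ≤ m + 1) :
    ∑ i ∈ Finset.range k, ((i : ℝ) - m * t) * bernsteinWeight m t i
      = -(k * (1 - t) * bernsteinWeight m t k) := by
  induction k with
  | zero => simp
  | succ k ih =>
    rw [Finset.sum_range_succ, ih (by omega)]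
    have h := succ_mul_bernsteinWeight_succ m t (i := k) (by omega)
    push_cast
    linear_combination h

theorem sum_sub_mul_bernsteinWeight (m : ℕ) (t : ℝ) :
    ∑ i ∈ Finset.range (m + 1), ((i : ℝ) - m * t) * bernsteinWeight m t i = 0 := by
  rw [sum_range_sub_mul_bernsteinWeight m t le_rfl]
  simp [bernsteinWeight]

theorem sum_mul_bernsteinWeight (m : ℕ) (t : ℝ) :
    ∑ i ∈ Finset.range (m + 1), (i : ℝ) * bernsteinWeight m t i = m * t := by
  have h := sum_sub_mul_bernsteinWeight m t
  simp only [sub_mul, Finset.sum_sub_distrib, ← Finset.mul_sum, sum_bernsteinWeight] at h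
  linarith

theorem exists_hasDerivAt_bernsteinWeight (m : ℕ) {t : ℝ} {i : ℕ} (hi : i ≤ m) :
    ∃ d, HasDerivAt (fun x => bernsteinWeight m x i) d t ∧
      t * (1 - t) * d = ((i : ℝ) - m * t) * bernsteinWeight m t i := by
  have h1 : HasDerivAt (fun x : ℝ => (m.choose i : ℝ) * x ^ i)
      ((m.choose i : ℝ) * (i * t ^ (i - 1))) t := (hasDerivAt_pow i t).const_mul _
  have h2 : HasDerivAt (fun x : ℝ => (1 - x) ^ (m - i))
      (((m - i : ℕ) : ℝ) * (1 - t) ^ (m - i - 1) * (-1)) t :=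
    ((hasDerivAt_id t).const_sub 1).pow (m - i)
  refine ⟨_, h1.mul h2, ?_⟩
  have e (a : ℝ) (k : ℕ) : (k : ℝ) * a ^ (k - 1) * a = k * a ^ k := by
    cases k with
    | zero => simp
    | succ k => rw [Nat.add_sub_cancel, pow_succ]; ring
  have e1 := e t i
  have e2 := e (1 - t) (m - i)
  rw [Nat.cast_sub hi] at e2 ⊢
  unfold bernsteinWeight
  linear_combination (m.choose i : ℝ) * (1 - t) * (1 - t) ^ (m - i) * e1
    - (m.choose i : ℝ) * t * t ^ i * e2

/-- The Bernstein operator preserves monotonicity. -/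
theorem monotoneOn_sum_mul_bernsteinWeight (m : ℕ) {f : ℝ → ℝ} (hf : Monotone f) :
    MonotoneOn (fun t => ∑ i ∈ Finset.range (m + 1), f i * bernsteinWeight m t i)
      (Set.Icc 0 1) := by
  have hd (t : ℝ) : ∃ d,
      HasDerivAt (fun t => ∑ i ∈ Finset.range (m + 1), f i * bernsteinWeight m t i) d t ∧
      t * (1 - t) * d = ∑ i ∈ Finset.range (m + 1),
        f i * (((i : ℝ) - m * t) * bernsteinWeight m t i) := by
    have h (i : ℕ) : ∃ d, i ∈ Finset.range (m + 1) →
        HasDerivAt (fun x => bernsteinWeight m x i) d t ∧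
        t * (1 - t) * d = ((i : ℝ) - m * t) * bernsteinWeight m t i := by
      by_cases hi : i ≤ m
      · obtain ⟨d, hd⟩ := exists_hasDerivAt_bernsteinWeight m (t := t) hi
        exact ⟨d, fun _ => hd⟩
      · exact ⟨0, fun h => absurd (Finset.mem_range_succ_iff.1 h) hi⟩
    choose d hd using h
    refine ⟨∑ i ∈ Finset.range (m + 1), f i * d i,
      HasDerivAt.fun_sum fun i hi => (hd i hi).1.const_mul _, ?_⟩
    rw [Finset.mul_sum]
    refine Finset.sum_congr rfl fun i hi => ?_
    rw [← (hd i hi).2]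
    ring
  refine monotoneOn_of_deriv_nonneg (convex_Icc 0 1)
    (fun t _ => (hd t).choose_spec.1.continuousAt.continuousWithinAt)
    (fun t _ => (hd t).choose_spec.1.differentiableAt.differentiableWithinAt) fun t ht => ?_
  rw [interior_Icc] at ht
  obtain ⟨d, h1, h2⟩ := hd t
  rw [h1.deriv]
  have h3 : t * (1 - t) * d = ∑ i ∈ Finset.range (m + 1),
      (f i - f (m * t)) * (((i : ℝ) - m * t) * bernsteinWeight m t i) := by
    simp only [h2, sub_mul (f _), Finset.sum_sub_distrib, ← Finset.mul_sum,
      sum_sub_mul_bernsteinWeight, mul_zero, sub_zero]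
  have h4 : 0 ≤ t * (1 - t) * d := by
    rw [h3]
    refine Finset.sum_nonneg fun i _ => ?_
    rw [← mul_assoc]
    refine mul_nonneg ?_ (bernsteinWeight_nonneg m ⟨ht.1.le, ht.2.le⟩ i)
    rcases le_total (i : ℝ) (m * t) with h | h
    · exact mul_nonneg_of_nonpos_of_nonpos (sub_nonpos.2 (hf h)) (sub_nonpos.2 h)
    · exact mul_nonneg (sub_nonneg.2 (hf h)) (sub_nonneg.2 h)
  exact nonneg_of_mul_nonneg_right h4 (mul_pos ht.1 (sub_pos.2 ht.2))

theorem sum_max_sub_mul_bernsteinWeight_sub (m : ℕ) (t c : ℝ) :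
    ∑ i ∈ Finset.range (m + 1), max ((i : ℝ) - c) 0 * bernsteinWeight m t i
      - ∑ i ∈ Finset.range (m + 1), max (c - i) 0 * bernsteinWeight m t i = m * t - c := by
  rw [← Finset.sum_sub_distrib, ← sum_mul_bernsteinWeight m t]
  nth_rw 3 [← mul_one c]
  rw [← sum_bernsteinWeight m t, Finset.mul_sum, ← Finset.sum_sub_distrib]
  refine Finset.sum_congr rfl fun i _ => ?_
  rw [← sub_mul, ← sub_mul]
  congr 1
  rcases le_total (i : ℝ) c with h | h
  · rw [max_eq_right (sub_nonpos.2 h), max_eq_left (sub_nonneg.2 h)]; ring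
  · rw [max_eq_left (sub_nonneg.2 h), max_eq_right (sub_nonpos.2 h)]; ring

/-- Half the mean absolute deviation of a binomial law with integer mean `k`. -/
theorem sum_max_mul_bernsteinWeight_of_mean (m : ℕ) {t : ℝ} {k : ℕ} (hk : k ≤ m)
    (hmt : m * t = k) :
    ∑ i ∈ Finset.range (m + 1), max ((k : ℝ) - i) 0 * bernsteinWeight m t i
      = m * t * (1 - t) * bernsteinWeight m t k := by
  have h := sum_range_sub_mul_bernsteinWeight m t (k := k) (by omega)
  rw [hmt, ← neg_neg (_ * bernsteinWeight m t k), ← h, ← Finset.sum_neg_distrib]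
  symm
  refine Finset.sum_subset_zero_on_sdiff (Finset.range_subset_range.2 (by omega)) ?_ ?_
  · intro i hi
    have : (k : ℝ) ≤ i := by
      simp only [Finset.mem_sdiff, Finset.mem_range, not_lt] at hi
      exact_mod_cast hi.2
    rw [max_eq_right (sub_nonpos.2 this), zero_mul]
  · intro i hi
    have : (i : ℝ) ≤ k := by exact_mod_cast (Finset.mem_range.1 hi).le
    rw [max_eq_left (sub_nonneg.2 this), hmt]
    ring

theorem sum_max_mul_bernsteinWeight_of_mean_le (m : ℕ) {t : ℝ} (ht : t ∈ Set.Icc (0 : ℝ) 1)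
    {k : ℕ} (hk : k ≤ m) (hmt : m * t = k) :
    ∑ i ∈ Finset.range (m + 1), max ((k : ℝ) - i) 0 * bernsteinWeight m t i
      ≤ m / (4 * √(m + 1)) := by
  set b := bernsteinWeight m t with hb
  have hb0 := bernsteinWeight_nonneg m ht
  have hE := sum_max_mul_bernsteinWeight_of_mean m hk hmt
  have hsub := sum_max_sub_mul_bernsteinWeight_sub m t k
  set E := ∑ i ∈ Finset.range (m + 1), max ((k : ℝ) - i) 0 * b i
  have hD : ∑ i ∈ Finset.range (m + 1), |(i : ℝ) - k| * b i = 2 * E := by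
    have : ∑ i ∈ Finset.range (m + 1), |(i : ℝ) - k| * b i
        = ∑ i ∈ Finset.range (m + 1), max ((i : ℝ) - k) 0 * b i + E := by
      rw [← Finset.sum_add_distrib]
      refine Finset.sum_congr rfl fun i _ => ?_
      rw [← add_mul, ← max_zero_add_max_neg_zero_eq_abs_self, neg_sub, max_comm]
    linarith
  have hV : ∑ i ∈ Finset.range (m + 1), ((i : ℝ) - k) ^ 2 * b i = m * t * (1 - t) := by
    rw [← sum_sq_mul_bernsteinWeight m t, hmt]
  have hP : ∑ i ∈ Finset.range (m + 1), (if i = k then 0 else b i) = 1 - b k := by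
    rw [← sum_bernsteinWeight m t, eq_sub_iff_add_eq]
    have : b k = ∑ i ∈ Finset.range (m + 1), (if i = k then b i else 0) := by
      rw [Finset.sum_ite_eq', if_pos (Finset.mem_range_succ_iff.2 hk)]
    rw [this, ← Finset.sum_add_distrib]
    refine Finset.sum_congr rfl fun i _ => ?_
    split_ifs <;> simp [hb]
  have hCS : (2 * E) ^ 2 ≤ m * t * (1 - t) * (1 - b k) := by
    rw [← hD, ← hV, ← hP]
    refine Finset.sum_sq_le_sum_mul_sum_of_sq_le_mul _
      (fun i _ => mul_nonneg (sq_nonneg _) (hb0 i))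
      (fun i _ => by split_ifs; exacts [le_rfl, hb0 i]) fun i _ => le_of_eq ?_
    split_ifs with h
    · simp [h]
    · rw [mul_pow, sq_abs]; ring
  have hv : (m : ℝ) * t * (1 - t) ≤ m / 4 := by
    have : (0 : ℝ) ≤ m := Nat.cast_nonneg m
    nlinarith [mul_nonneg this (sq_nonneg (2 * t - 1))]
  have hquad : 4 * E ^ 2 + E ≤ m / 4 := by
    rw [mul_sub, ← hE] at hCS
    linarith
  have hm0 : (0 : ℝ) ≤ m := Nat.cast_nonneg m
  have hs1 : 1 ≤ √((m : ℝ) + 1) := Real.one_le_sqrt.2 (by linarith)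
  have hs2 : √((m : ℝ) + 1) ^ 2 = m + 1 := Real.sq_sqrt (by linarith)
  set s := √((m : ℝ) + 1)
  by_contra! hlt
  have h2 : (m / (4 * s)) ^ 2 ≤ E ^ 2 := by gcongr
  have h3 : (m : ℝ) / 4 ≤ 4 * (m / (4 * s)) ^ 2 + m / (4 * s) := by
    have : 4 * (m / (4 * s)) ^ 2 + m / (4 * s) - m / 4 = m * (s - 1) / (4 * s ^ 2) := by
      field_simp
      rw [hs2]
      ring
    have h4 : 0 ≤ m * (s - 1) / (4 * s ^ 2) :=
      div_nonneg (mul_nonneg hm0 (by linarith)) (by positivity)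
    linarith
  linarith

/-- The Bernstein operator of degree `m` moves a hinge function with a knot at a node by at
most `m / (4√(m+1))`, in the scale in which the nodes are the integers. -/
theorem abs_sum_max_mul_bernsteinWeight_sub_le (m : ℕ) {t : ℝ} (ht : t ∈ Set.Icc (0 : ℝ) 1)
    {k : ℕ} (hk : k ≤ m) :
    |∑ i ∈ Finset.range (m + 1), max ((i : ℝ) - k) 0 * bernsteinWeight m t i
      - max (m * t - k) 0| ≤ m / (4 * √(m + 1)) := by
  rcases m.eq_zero_or_pos with rfl | hm
  · obtain rfl : k = 0 := by omega
    simp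
  have hm' : (0 : ℝ) < m := by exact_mod_cast hm
  set u : ℝ := k / m
  have hmu : m * u = k := mul_div_cancel₀ _ hm'.ne'
  have hu : u ∈ Set.Icc (0 : ℝ) 1 :=
    ⟨by positivity, div_le_one_of_le₀ (by exact_mod_cast hk) hm'.le⟩
  have hbound := sum_max_mul_bernsteinWeight_of_mean_le m hu hk hmu
  have hsubt := sum_max_sub_mul_bernsteinWeight_sub m t k
  have hsubu := sum_max_sub_mul_bernsteinWeight_sub m u k
  have hb0 := bernsteinWeight_nonneg m ht
  rcases le_total t u with htu | htu
  · have h1 : (m : ℝ) * t - k ≤ 0 := by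
      rw [← hmu, sub_nonpos]
      gcongr
    have hmono := monotoneOn_sum_mul_bernsteinWeight m (f := fun x => max (x - k) 0)
      (fun x y h => max_le_max (sub_le_sub_right h _) le_rfl) ht hu htu
    rw [max_eq_right h1, sub_zero, abs_of_nonneg
      (Finset.sum_nonneg fun i _ => mul_nonneg (le_max_right _ _) (hb0 i))]
    simp only at hmono
    linarith
  · have h1 : 0 ≤ (m : ℝ) * t - k := by
      rw [← hmu, sub_nonneg]
      gcongr
    have hmono := monotoneOn_sum_mul_bernsteinWeight m (f := fun x => -max (k - x) 0)
      (fun x y h => neg_le_neg (max_le_max (sub_le_sub_left h _) le_rfl)) hu ht htu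
    simp only [neg_mul, Finset.sum_neg_distrib, neg_le_neg_iff] at hmono
    have : ∑ i ∈ Finset.range (m + 1), max ((i : ℝ) - k) 0 * bernsteinWeight m t i
        - (m * t - k) = ∑ i ∈ Finset.range (m + 1), max ((k : ℝ) - i) 0 *
          bernsteinWeight m t i := by linarith
    rw [max_eq_left h1, this, abs_of_nonneg
      (Finset.sum_nonneg fun i _ => mul_nonneg (le_max_right _ _) (hb0 i))]
    linarith

/-- The piecewise-linear function `a + b x + Σ_{k<l} c k * max (x - q (k+1)) 0`, whose knots are
multiples of the natural number `q`. -/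
noncomputable def hingeSum (a b : ℝ) (c : ℕ → ℝ) (q l : ℕ) (x : ℝ) : ℝ :=
  a + b * x + ∑ k ∈ Finset.range l, c k * max (x - (q * (k + 1) : ℕ)) 0

theorem max_natCast_add_sub_natCast (i q : ℕ) {θ : ℝ} (hθ : θ ∈ Set.Icc (0 : ℝ) 1) :
    max ((i : ℝ) + θ - q) 0
      = max ((i : ℝ) - q) 0 + θ * (max (((i + 1 : ℕ) : ℝ) - q) 0 - max ((i : ℝ) - q) 0) := by
  obtain ⟨h0, h1⟩ := hθ
  push_cast
  rcases Nat.lt_or_ge i q with h | h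
  · have h' : (i : ℝ) + 1 ≤ q := by exact_mod_cast h
    rw [max_eq_right (by linarith), max_eq_right (by linarith), max_eq_right (by linarith)]
    ring
  · have h' : (q : ℝ) ≤ i := by exact_mod_cast h
    rw [max_eq_left (by linarith), max_eq_left (by linarith), max_eq_left (by linarith)]
    ring

theorem hingeSum_natCast_add (a b : ℝ) (c : ℕ → ℝ) (q l i : ℕ) {θ : ℝ}
    (hθ : θ ∈ Set.Icc (0 : ℝ) 1) :
    hingeSum a b c q l (i + θ) = hingeSum a b c q l i
      + θ * (hingeSum a b c q l (i + 1 : ℕ) - hingeSum a b c q l i) := by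
  simp only [hingeSum, max_natCast_add_sub_natCast _ _ hθ, mul_add, Finset.sum_add_distrib,
    mul_sub, Finset.mul_sum, Finset.sum_sub_distrib, mul_left_comm θ]
  push_cast
  ring

theorem hingeSum_two_mul (a b : ℝ) (c : ℕ → ℝ) (q l : ℕ) (x : ℝ) :
    hingeSum a (b / 2) (fun k => c k / 2) (2 * q) l (2 * x) = hingeSum a b c q l x := by
  unfold hingeSum
  congr 1
  · ring
  refine Finset.sum_congr rfl fun k _ => ?_
  have : (2 * x - (2 * q * (k + 1) : ℕ) : ℝ) = 2 * (x - (q * (k + 1) : ℕ)) := by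
    push_cast
    ring
  rw [this, ← mul_zero (2 : ℝ), ← mul_max_of_nonneg _ _ zero_le_two, mul_zero]
  ring

theorem minsert_eq_hingeSum {R : ℕ → EuclideanSpace ℝ (Fin 3)} {w : Fin 3} {a b : ℝ}
    {c : ℕ → ℝ} {q l m : ℕ} (h : ∀ i ≤ m, R i w = hingeSum a b c q l i) (i : ℕ)
    (hi : i ≤ 2 * m) :
    minsert R i w = hingeSum a (b / 2) (fun k => c k / 2) (2 * q) l i := by
  rcases Nat.even_or_odd' i with ⟨r, rfl | rfl⟩
  · have : minsert R (2 * r) = R r := by simp [minsert]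
    rw [this, h r (by omega), Nat.cast_mul, Nat.cast_two, hingeSum_two_mul]
  · have : minsert R (2 * r + 1) = (2⁻¹ : ℝ) • (R r + R (r + 1)) := by
      have e : (2 * r + 1) / 2 = r := by omega
      simp [minsert, e, Nat.add_mod]
    have e : ((2 * r + 1 : ℕ) : ℝ) = 2 * (r + 2⁻¹) := by push_cast; ring
    rw [this, e, hingeSum_two_mul, hingeSum_natCast_add _ _ _ _ _ _ (by norm_num),
      ← h r (by omega), ← h (r + 1) (by omega)]
    simp only [PiLp.smul_apply, PiLp.add_apply, smul_eq_mul]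
    ring

theorem iterate_minsert_eq_hingeSum {R : ℕ → EuclideanSpace ℝ (Fin 3)} {w : Fin 3} {a b : ℝ}
    {c : ℕ → ℝ} {l m : ℕ} (h : ∀ i ≤ m, R i w = hingeSum a b c 1 l i) (j : ℕ) :
    ∀ i ≤ 2 ^ j * m, minsert^[j] R i w
      = hingeSum a (b / 2 ^ j) (fun k => c k / 2 ^ j) (2 ^ j) l i := by
  induction j with
  | zero => simpa using h
  | succ j ih =>
    intro i hi
    rw [Function.iterate_succ_apply', minsert_eq_hingeSum ih i (by rw [pow_succ] at hi; linarith)]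
    simp only [pow_succ, div_div, mul_comm (2 : ℕ)]

theorem apply_succ_sub_apply_eq (R : ℕ → EuclideanSpace ℝ (Fin 3)) (w : Fin 3) (i : ℕ) :
    R (i + 1) w - R i w = R 1 w - R 0 w + ∑ k ∈ Finset.range i, delta2 R k w := by
  induction i with
  | zero => simp
  | succ i ih =>
    rw [Finset.sum_range_succ, ← add_assoc, ← ih]
    simp only [delta2, PiLp.add_apply, PiLp.sub_apply, PiLp.smul_apply, smul_eq_mul]
    ring

theorem apply_succ_eq_sum_delta2 (R : ℕ → EuclideanSpace ℝ (Fin 3)) (w : Fin 3) (i : ℕ) :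
    R (i + 1) w = R 0 w + (R 1 w - R 0 w) * (i + 1)
      + ∑ k ∈ Finset.range i, delta2 R k w * ((i : ℝ) - k) := by
  induction i with
  | zero => simp
  | succ i ih =>
    have h := apply_succ_sub_apply_eq R w (i + 1)
    have e : ∑ k ∈ Finset.range (i + 1), delta2 R k w * (((i + 1 : ℕ) : ℝ) - k)
        = ∑ k ∈ Finset.range i, delta2 R k w * ((i : ℝ) - k)
          + ∑ k ∈ Finset.range (i + 1), delta2 R k w := by
      have e' : ∑ k ∈ Finset.range i, delta2 R k w * ((i : ℝ) - k)
          = ∑ k ∈ Finset.range (i + 1), delta2 R k w * ((i : ℝ) - k) := by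
        simp [Finset.sum_range_succ]
      rw [e', ← Finset.sum_add_distrib]
      refine Finset.sum_congr rfl fun k _ => ?_
      push_cast
      ring
    rw [e]
    push_cast
    linarith

theorem apply_eq_hingeSum (R : ℕ → EuclideanSpace ℝ (Fin 3)) (w : Fin 3) {n i : ℕ}
    (hi : i ≤ n) :
    R i w = hingeSum (R 0 w) (R 1 w - R 0 w) (fun k => delta2 R k w) 1 (n - 1) i := by
  unfold hingeSum
  cases i with
  | zero =>
    have (k : ℕ) : max (((0 : ℕ) : ℝ) - (1 * (k + 1) : ℕ)) 0 = 0 :=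
      max_eq_right (by push_cast; linarith [(Nat.cast_nonneg k : (0 : ℝ) ≤ k)])
    simp only [this]
    simp
  | succ i =>
    rw [apply_succ_eq_sum_delta2, Nat.cast_succ]
    congr 1
    refine Finset.sum_subset_zero_on_sdiff (Finset.range_subset_range.2 (by omega)) ?_ ?_
    · intro k hk
      have : (i : ℝ) ≤ k := by
        simp only [Finset.mem_sdiff, Finset.mem_range, not_lt] at hk
        exact_mod_cast hk.2
      rw [max_eq_right (by push_cast; linarith), mul_zero]
    · intro k hk
      have : (k : ℝ) ≤ i := by exact_mod_cast (Finset.mem_range.1 hk).le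
      rw [max_eq_left (by push_cast; linarith)]
      push_cast
      ring

theorem plParam_eq_hingeSum {R : ℕ → EuclideanSpace ℝ (Fin 3)} {w : Fin 3} {a b : ℝ}
    {c : ℕ → ℝ} {q l m : ℕ} (h : ∀ i ≤ m, R i w = hingeSum a b c q l i) {t : ℝ}
    (ht : t ∈ Set.Icc (0 : ℝ) 1) :
    plParam m R t w = hingeSum a b c q l (m * t) := by
  have hx0 : 0 ≤ (m : ℝ) * t := mul_nonneg (Nat.cast_nonneg m) ht.1
  have hxm : (m : ℝ) * t ≤ m := mul_le_of_le_one_right (Nat.cast_nonneg m) ht.2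
  have hfl := Nat.floor_le hx0
  have hlt := Nat.lt_floor_add_one ((m : ℝ) * t)
  simp only [plParam, PiLp.add_apply, PiLp.sub_apply, PiLp.smul_apply, smul_eq_mul]
  generalize (m : ℝ) * t = x at *
  set N := ⌊x⌋₊
  have hN : N ≤ m := by exact_mod_cast hfl.trans hxm
  rcases hN.eq_or_lt with hNm | hNm
  · have hx : x = N := le_antisymm (hNm ▸ hxm) hfl
    rw [← hx, sub_self, zero_mul, add_zero, h N hN, ← hx]
  · have := hingeSum_natCast_add a b c q l N (θ := x - N) ⟨by linarith, by linarith⟩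
    rw [add_sub_cancel] at this
    rw [this, h N hN, h (N + 1) hNm]

theorem bezier_eq_hingeSum {R : ℕ → EuclideanSpace ℝ (Fin 3)} {w : Fin 3} {a b : ℝ}
    {c : ℕ → ℝ} {q l m : ℕ} (h : ∀ i ≤ m, R i w = hingeSum a b c q l i) (t : ℝ) :
    bezier m R t w = a + b * (m * t) + ∑ k ∈ Finset.range l, c k *
      ∑ i ∈ Finset.range (m + 1), max ((i : ℝ) - (q * (k + 1) : ℕ)) 0 *
        bernsteinWeight m t i := by
  have h1 : bezier m R t w = ∑ i ∈ Finset.range (m + 1),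
      hingeSum a b c q l i * bernsteinWeight m t i := by
    simp only [bezier, WithLp.ofLp_sum, Finset.sum_apply, PiLp.smul_apply, smul_eq_mul]
    refine Finset.sum_congr rfl fun i hi => ?_
    rw [h i (Finset.mem_range_succ_iff.1 hi), mul_comm]
    rfl
  rw [h1]
  simp only [hingeSum, add_mul, Finset.sum_add_distrib, mul_assoc, ← Finset.mul_sum,
    sum_bernsteinWeight, sum_mul_bernsteinWeight, mul_one, Finset.sum_mul]
  rw [Finset.sum_comm]
  simp only [← Finset.mul_sum]

theorem abs_bezier_sub_plParam_le {R : ℕ → EuclideanSpace ℝ (Fin 3)} {w : Fin 3} {a b : ℝ}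
    {c : ℕ → ℝ} {q l m : ℕ} (h : ∀ i ≤ m, R i w = hingeSum a b c q l i) (hl : q * l ≤ m)
    {t : ℝ} (ht : t ∈ Set.Icc (0 : ℝ) 1) :
    |bezier m R t w - plParam m R t w|
      ≤ m / (4 * √(m + 1)) * ∑ k ∈ Finset.range l, |c k| := by
  rw [bezier_eq_hingeSum h, plParam_eq_hingeSum h ht, hingeSum, add_sub_add_left_eq_sub,
    ← Finset.sum_sub_distrib, Finset.mul_sum]
  refine (Finset.abs_sum_le_sum_abs _ _).trans (Finset.sum_le_sum fun k hk => ?_)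
  rw [← mul_sub, abs_mul, mul_comm]
  refine mul_le_mul_of_nonneg_right (abs_sum_max_mul_bernsteinWeight_sub_le m ht ?_)
    (abs_nonneg _)
  exact (Nat.mul_le_mul_left q (Finset.mem_range.1 hk)).trans hl

/-- After `j` midpoint insertions on an even-degree control polygon (`n ≥ 2` even),
the coordinatewise distance between the degree-`2^j·n` Bézier curve `B⁽ʲ⁾` and its
control polygon `𝒫⁽ʲ⁾` is at most `(n / (4√(n·2^j + 1)))·‖Δ₂P‖_{1,M}`. -/
theorem bezier_polygon_dist_iter (n : ℕ) (hn : 2 ≤ n) (hev : Even n)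
    (P : ℕ → EuclideanSpace ℝ (Fin 3)) (j : ℕ) (t : ℝ) (ht : t ∈ Set.Icc (0 : ℝ) 1)
    (w : Fin 3) :
    |bezier (2 ^ j * n) (minsert^[j] P) t w - plParam (2 ^ j * n) (minsert^[j] P) t w| ≤
      ((n : ℝ) / (4 * Real.sqrt ((n : ℝ) * 2 ^ j + 1))) * norm1M n P := by
  have h := abs_bezier_sub_plParam_le
    (iterate_minsert_eq_hingeSum (fun i hi => apply_eq_hingeSum P w (n := n) hi) j)
    (Nat.mul_le_mul_left _ (Nat.sub_le n 1)) ht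
  have hle : ∑ k ∈ Finset.range (n - 1), |delta2 P k w| ≤ norm1M n P :=
    le_ciSup (f := fun w : Fin 3 => ∑ i ∈ Finset.range (n - 1), |delta2 P i w|)
      (Set.finite_range _).bddAbove w
  refine h.trans (le_trans (le_of_eq ?_) (mul_le_mul_of_nonneg_left hle (by positivity)))
  simp only [abs_div, abs_pow, Nat.abs_ofNat, ← Finset.sum_div]
  push_cast
  rw [mul_comm (n : ℝ)]
  field_simp
end

section
/- Let n ≥ 2 be even and let P₀, …, Pₙ ∈ ℝ³. For j ≥ 0 let P^{(j)} be the j-fold midpoint insertion of P, let B^{(j)} be the Bézier curve of degree 2^j·n with control points P^{(j)}, and let 𝒫 be the uniform piecewise-linear parametrization of P₀, …, Pₙ. Then B^{(j)} converges uniformly on [0,1] to 𝒫 as j → ∞; that is, sup_{t ∈ [0,1]} ‖B^{(j)}(t) − 𝒫(t)‖ → 0 as j → ∞. -/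
/-- The piecewise-linear interpolation of a sequence of points with knots at the naturals. -/
noncomputable def linInterp (R : ℕ → EuclideanSpace ℝ (Fin 3)) (x : ℝ) :
    EuclideanSpace ℝ (Fin 3) :=
  R ⌊x⌋₊ + (x - ⌊x⌋₊) • (R (⌊x⌋₊ + 1) - R ⌊x⌋₊)

lemma linInterp_eq {R : ℕ → EuclideanSpace ℝ (Fin 3)} {x : ℝ} {k : ℕ}
    (h₁ : (k : ℝ) ≤ x) (h₂ : x < k + 1) :
    linInterp R x = R k + (x - k) • (R (k + 1) - R k) := by
  have h : ⌊x⌋₊ = k := (Nat.floor_eq_iff (k.cast_nonneg.trans h₁)).2 ⟨h₁, h₂⟩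
  rw [linInterp, h]

lemma linInterp_natCast (R : ℕ → EuclideanSpace ℝ (Fin 3)) (k : ℕ) : linInterp R k = R k := by
  simp [linInterp]

lemma minsert_two_mul (R : ℕ → EuclideanSpace ℝ (Fin 3)) (k : ℕ) :
    minsert R (2 * k) = R k := by
  simp [minsert]

lemma minsert_two_mul_add_one (R : ℕ → EuclideanSpace ℝ (Fin 3)) (k : ℕ) :
    minsert R (2 * k + 1) = (2⁻¹ : ℝ) • (R k + R (k + 1)) := by
  have h₁ : (2 * k + 1) % 2 = 1 := by omega
  have h₂ : (2 * k + 1) / 2 = k := by omega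
  simp [minsert, h₁, h₂]

/-- Midpoint insertion does not change the interpolated polygon. -/
lemma linInterp_minsert (R : ℕ → EuclideanSpace ℝ (Fin 3)) {x : ℝ} (hx : 0 ≤ x) :
    linInterp (minsert R) (2 * x) = linInterp R x := by
  obtain ⟨k, h₁, h₂⟩ : ∃ k : ℕ, (k : ℝ) ≤ x ∧ x < k + 1 :=
    ⟨⌊x⌋₊, Nat.floor_le hx, Nat.lt_floor_add_one x⟩
  rw [linInterp_eq h₁ h₂]
  rcases lt_or_ge (2 * x) (2 * k + 1) with h | h
  · rw [linInterp_eq (k := 2 * k) (by push_cast; linarith) (by push_cast; linarith),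
      minsert_two_mul, minsert_two_mul_add_one]
    push_cast
    module
  · rw [linInterp_eq (k := 2 * k + 1) (by push_cast; linarith) (by push_cast; linarith),
      minsert_two_mul_add_one, show 2 * k + 1 + 1 = 2 * (k + 1) by ring, minsert_two_mul]
    push_cast
    module

lemma minsert_iterate_apply (P : ℕ → EuclideanSpace ℝ (Fin 3)) (j i : ℕ) :
    minsert^[j] P i = linInterp P (i / 2 ^ j) := by
  induction j generalizing P with
  | zero => simp [linInterp_natCast]
  | succ j ih =>
    rw [Function.iterate_succ_apply, ih, ← linInterp_minsert P (by positivity)]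
    congr 1
    ring

/-- A formula for `linInterp` in which every summand is visibly continuous. -/
lemma linInterp_eq_sum (R : ℕ → EuclideanSpace ℝ (Fin 3)) {x : ℝ} (hx : 0 ≤ x) {N : ℕ}
    (hN : ⌊x⌋₊ < N) :
    linInterp R x =
      R 0 + ∑ k ∈ Finset.range N, max 0 (min 1 (x - k)) • (R (k + 1) - R k) := by
  induction N, hN using Nat.le_induction with
  | base =>
    have hle := Nat.floor_le hx
    have hlt := Nat.lt_floor_add_one x
    have hsum : ∑ k ∈ Finset.range ⌊x⌋₊, max 0 (min 1 (x - k)) • (R (k + 1) - R k) =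
        R ⌊x⌋₊ - R 0 := by
      rw [← Finset.sum_range_sub]
      refine Finset.sum_congr rfl fun k hk => ?_
      have hk' : (k : ℝ) + 1 ≤ ⌊x⌋₊ := by exact_mod_cast Finset.mem_range.1 hk
      rw [min_eq_left (by linarith), max_eq_right zero_le_one, one_smul]
    rw [Nat.succ_eq_add_one, Finset.sum_range_succ, hsum, min_eq_right (by linarith),
      max_eq_right (by linarith), linInterp]
    abel
  | succ N hN ih =>
    have hxN : x < N := (Nat.floor_lt hx).1 hN
    rw [Finset.sum_range_succ, ← add_assoc, ← ih,
      max_eq_left ((min_le_right _ _).trans (by linarith)), zero_smul, add_zero]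

lemma continuousOn_linInterp (R : ℕ → EuclideanSpace ℝ (Fin 3)) (n : ℕ) :
    ContinuousOn (linInterp R) (Set.Icc 0 n) := by
  have h : Continuous fun x : ℝ =>
      R 0 + ∑ k ∈ Finset.range (n + 1), max 0 (min 1 (x - k)) • (R (k + 1) - R k) := by
    fun_prop
  refine h.continuousOn.congr fun x hx => linInterp_eq_sum R hx.1 ?_
  exact Nat.lt_succ_of_le (Nat.floor_le_of_le hx.2)

lemma continuous_plParam (n : ℕ) (P : ℕ → EuclideanSpace ℝ (Fin 3)) :
    Continuous fun t : unitInterval => plParam n P t := by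
  refine (continuousOn_linInterp P n).comp_continuous (f := fun t : unitInterval => (n : ℝ) * t)
    (by fun_prop) fun t => ⟨mul_nonneg n.cast_nonneg t.2.1, ?_⟩
  exact mul_le_of_le_one_right n.cast_nonneg t.2.2

/-- The Bézier curve of the refined polygon is a Bernstein approximation of the polygon. -/
lemma bezier_minsert_iterate {n : ℕ} (hn : n ≠ 0) (P : ℕ → EuclideanSpace ℝ (Fin 3)) (j : ℕ)
    (t : unitInterval) :
    bezier (2 ^ j * n) (minsert^[j] P) t =
      bernsteinApproximation (2 ^ j * n) ⟨_, continuous_plParam n P⟩ t := by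
  rw [bernsteinApproximation.apply, bezier, Finset.sum_range]
  refine Finset.sum_congr rfl fun i _ => ?_
  rw [bernstein_apply, minsert_iterate_apply]
  congr 1
  change _ = linInterp P (n * ((i : ℝ) / ((2 ^ j * n : ℕ) : ℝ)))
  congr 1
  push_cast
  field_simp

/-- For `n ≥ 2` even, the Bézier curves `B⁽ʲ⁾` of the iterated midpoint insertions
converge uniformly on `[0,1]` to the uniform piecewise-linear parametrization `𝒫` of
the original control points: `sup_{t ∈ [0,1]} ‖B⁽ʲ⁾(t) - 𝒫(t)‖ → 0` as `j → ∞`. -/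
theorem bezier_tendstoUniformly (n : ℕ) (hn : 2 ≤ n) (hev : Even n)
    (P : ℕ → EuclideanSpace ℝ (Fin 3)) :
    Filter.Tendsto
      (fun j : ℕ => ⨆ t : Set.Icc (0 : ℝ) 1,
        ‖bezier (2 ^ j * n) (minsert^[j] P) t - plParam n P t‖)
      Filter.atTop (nhds 0) := by
  let f : C(unitInterval, EuclideanSpace ℝ (Fin 3)) := ⟨_, continuous_plParam n P⟩
  have hdeg : Filter.Tendsto (fun j : ℕ => 2 ^ j * n) Filter.atTop Filter.atTop :=
    (tendsto_pow_atTop_atTop_of_one_lt one_lt_two).atTop_mul_const' (by omega)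
  have h := tendsto_iff_norm_sub_tendsto_zero.1 ((bernsteinApproximation_uniform f).comp hdeg)
  refine h.congr fun j => ?_
  rw [ContinuousMap.norm_eq_iSup_norm]
  refine iSup_congr fun t => ?_
  rw [bezier_minsert_iterate (by omega) P j t]
  rfl
end
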